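/- Let Γ ∈ 𝒢₃(θ0,θ1,θ2) have exactly three distinct vertex degrees. Then the coherent rank of Γ is at least 14; equivalently, every coherent configuration whose real linear span contains the adjacency matrix of Γ has rank at least 14. -/

import Mathlib

open Matrix

/-- `θ` is an eigenvalue of the (real) adjacency matrix of `G`. -/
def adjEig {V : Type} [Fintype V] [DecidableEq V] (G : SimpleGraph V) [DecidableRel G.Adj]
    (θ : ℝ) : Prop :=
  ∃ f : V → ℝ, f ≠ 0 ∧ (SimpleGraph.adjMatrix ℝ G).mulVec f = θ • f

/-- `Γ ∈ 𝒢₃(θ0,θ1,θ2)`: `Γ` is connected and the set of eigenvalues of its adjacency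
matrix is exactly `{θ0, θ1, θ2}`, where `θ0 > θ1 > θ2`. -/
def InG3 {V : Type} [Fintype V] [DecidableEq V] (G : SimpleGraph V) [DecidableRel G.Adj]
    (θ0 θ1 θ2 : ℝ) : Prop :=
  G.Connected ∧ θ1 < θ0 ∧ θ2 < θ1 ∧ {θ : ℝ | adjEig G θ} = {θ0, θ1, θ2}

/-- A coherent configuration of rank `r` on the finite set `V`, given as a family of
`{0,1}`-matrices `A 1, …, A r`. -/
def IsCoherentConfig {V : Type} [Fintype V] [DecidableEq V] {r : ℕ}
    (A : Fin r → Matrix V V ℝ) : Prop :=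
  (∀ i x y, A i x y = 0 ∨ A i x y = 1) ∧
  (∑ i, A i) = Matrix.of (fun _ _ => (1 : ℝ)) ∧
  (∀ i, ∃ j, (A i)ᵀ = A j) ∧
  (∃ Δ : Finset (Fin r), ∑ i ∈ Δ, A i = 1) ∧
  (∀ i j, A i * A j ∈ Submodule.span ℝ (Set.range A))

/-- The coherent rank of `G` is `n`: `n` is the least rank of a coherent configuration on
the vertex set of `G` whose real linear span contains the adjacency matrix of `G`. -/
def HasCoherentRank {V : Type} [Fintype V] [DecidableEq V] (G : SimpleGraph V)
    [DecidableRel G.Adj] (n : ℕ) : Prop :=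
  IsLeast {r : ℕ | ∃ A : Fin r → Matrix V V ℝ,
    IsCoherentConfig A ∧ SimpleGraph.adjMatrix ℝ G ∈ Submodule.span ℝ (Set.range A)} n

/-- The entrywise form of `M² = σM + cI + ααᵀ` with `α > 0` an eigenvector of the symmetric
`{0,1}`-matrix `M` with zero diagonal. -/
structure RankOneSquare {V : Type} [Fintype V] [DecidableEq V] (a : V → V → ℝ) (α : V → ℝ)
    (σ c θ : ℝ) : Prop where
  zero_or_one : ∀ x y, a x y = 0 ∨ a x y = 1
  symm : ∀ x y, a x y = a y x
  diag : ∀ x, a x x = 0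
  pos : ∀ x, 0 < α x
  sq : ∀ x y, ∑ z, a x z * a z y = σ * a x y + c * (if x = y then 1 else 0) + α x * α y
  eig : ∀ x, ∑ z, a x z * α z = θ * α x

namespace RankOneSquare

variable {V : Type} [Fintype V] [DecidableEq V] {a : V → V → ℝ} {α : V → ℝ} {σ c θ : ℝ}

theorem nonneg (H : RankOneSquare a α σ c θ) (x y : V) : 0 ≤ a x y := by
  rcases H.zero_or_one x y with h | h <;> simp [h]

theorem le_one (H : RankOneSquare a α σ c θ) (x y : V) : a x y ≤ 1 := by
  rcases H.zero_or_one x y with h | h <;> simp [h]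

theorem ne_of_eq_one (H : RankOneSquare a α σ c θ) {x y : V} (h : a x y = 1) : x ≠ y := by
  rintro rfl
  simp [H.diag] at h

theorem row_sum (H : RankOneSquare a α σ c θ) (x : V) : ∑ z, a x z = c + α x ^ 2 := by
  have h := H.sq x x
  rw [H.diag] at h
  have : ∑ z, a x z * a z x = ∑ z, a x z := by
    refine Finset.sum_congr rfl fun z _ => ?_
    rw [H.symm z x]
    rcases H.zero_or_one x z with h | h <;> simp [h]
  rw [← this, h]
  simp
  ring

theorem exists_common (H : RankOneSquare a α σ c θ) {x y : V} (hxy : x ≠ y) (h : a x y = 0) :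
    ∃ z, a x z = 1 ∧ a z y = 1 := by
  by_contra! hc
  have h1 := H.sq x y
  have h2 : ∑ z, a x z * a z y = 0 := by
    refine Finset.sum_eq_zero fun z _ => ?_
    rcases H.zero_or_one x z with h | h
    · simp [h]
    · rcases H.zero_or_one z y with h' | h'
      · simp [h']
      · exact absurd h' (hc z h)
  rw [h2, h, if_neg hxy] at h1
  nlinarith [mul_pos (H.pos x) (H.pos y)]

theorem exists_nat_sum (H : RankOneSquare a α σ c θ) (x y : V) :
    ∃ m : ℕ, ∑ z, a x z * a z y = m := by
  refine ⟨(Finset.univ.filter fun z => a x z = 1 ∧ a z y = 1).card, ?_⟩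
  rw [← Finset.sum_boole]
  refine Finset.sum_congr rfl fun z _ => ?_
  rcases H.zero_or_one x z with h | h <;> rcases H.zero_or_one z y with h' | h' <;> simp [h, h']

theorem exists_nat_mul (H : RankOneSquare a α σ c θ) {x y : V} (hxy : x ≠ y) (h : a x y = 0) :
    ∃ m : ℕ, α x * α y = m := by
  obtain ⟨m, hm⟩ := H.exists_nat_sum x y
  refine ⟨m, ?_⟩
  rw [← hm, H.sq, h, if_neg hxy]
  ring

/-- If `(1 + θ₁)(1 + θ₂) = 0` then the eigenvector is constant. -/
theorem eigenvector_const (H : RankOneSquare a α σ c θ) (hσ : c = σ + 1) (x y : V) :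
    α x = α y := by
  have le : ∀ x y, a x y = 1 → α y ≤ α x := by
    intro x y h
    have h1 := H.sq x y
    rw [h, if_neg (H.ne_of_eq_one h)] at h1
    have h2 : ∑ z, a x z * a z y ≤ ∑ z, (a x z - if z = y then 1 else 0) := by
      refine Finset.sum_le_sum fun z _ => ?_
      split_ifs with hz
      · subst hz
        simp [H.diag, h]
      · have := H.nonneg x z
        have := H.le_one z y
        nlinarith
    rw [Finset.sum_sub_distrib, H.row_sum] at h2
    simp only [Finset.sum_ite_eq', Finset.mem_univ, if_true] at h2
    have := H.pos x
    nlinarith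
  have eq : ∀ x y, a x y = 1 → α x = α y := fun x y h =>
    le_antisymm (le y x (by rwa [H.symm])) (le x y h)
  by_cases hxy : x = y
  · rw [hxy]
  rcases H.zero_or_one x y with h | h
  · obtain ⟨z, h1, h2⟩ := H.exists_common hxy h
    rw [eq x z h1, eq z y h2]
  · exact eq x y h

theorem no_adjacent_twins (H : RankOneSquare a α σ c θ) {u v : V} (huv : α u ≠ α v)
    {x y : V} (hα : α x = α y) (h : a x y = 1)
    (hw : ∀ w, w ≠ x → w ≠ y → a x w = a y w) : False := by
  refine huv (H.eigenvector_const ?_ u v)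
  have h1 := H.sq x y
  have h2 := H.sq x x
  rw [h, if_neg (H.ne_of_eq_one h)] at h1
  rw [H.diag, if_pos rfl] at h2
  have h3 : ∑ z, (a x z * a z x - a x z * a z y) = ∑ z, if z = y then 1 else 0 := by
    refine Finset.sum_congr rfl fun z _ => ?_
    split_ifs with hz
    · subst hz
      simp [H.diag, h, H.symm z x]
    · by_cases hzx : z = x
      · subst hzx
        simp [H.diag]
      · rw [H.symm z x, H.symm z y, hw z hzx hz]
        ring
  rw [Finset.sum_sub_distrib] at h3
  simp only [Finset.sum_ite_eq', Finset.mem_univ, if_true] at h3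
  rw [hα] at h1 h2
  linarith

/-- Three vertices with pairwise covering neighbourhoods cannot have distinct `α`. -/
theorem no_covering_triple (H : RankOneSquare a α σ c θ) {x y z : V}
    (hxz : α x ≠ α z) (hyz : α y ≠ α z) (axy : a x y = 1) (axz : a x z = 1) (ayz : a y z = 1)
    (cxy : ∀ w, a x w = 1 ∨ a y w = 1) (cxz : ∀ w, a x w = 1 ∨ a z w = 1)
    (cyz : ∀ w, a y w = 1 ∨ a z w = 1) : False := by
  have key : ∀ x y, a x y = 1 → (∀ w, a x w = 1 ∨ a y w = 1) →
      σ + α x * α y = 2 * c + α x ^ 2 + α y ^ 2 - Fintype.card V := by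
    intro x y h hw
    have h1 := H.sq x y
    rw [h, if_neg (H.ne_of_eq_one h)] at h1
    have h2 : ∑ z, a x z * a z y = ∑ z, (a x z + a y z - 1) := by
      refine Finset.sum_congr rfl fun z _ => ?_
      rw [H.symm z y]
      rcases hw z with h | h <;> rw [h] <;> ring
    rw [Finset.sum_sub_distrib, Finset.sum_add_distrib, H.row_sum, H.row_sum] at h2
    simp only [Finset.sum_const, Finset.card_univ, nsmul_eq_mul, mul_one] at h2
    linarith
  have h1 := key x y axy cxy
  have h2 := key x z axz cxz
  have h3 := key y z ayz cyz
  have e1 : α y + α z = α x :=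
    mul_left_cancel₀ (sub_ne_zero.2 hyz) (by linarith)
  have e2 : α x + α z = α y :=
    mul_left_cancel₀ (sub_ne_zero.2 hxz) (by linarith)
  have := H.pos z
  linarith

end RankOneSquare

/-- Splitting a sum over the three values of a function. -/
theorem sum_eq_sum_three_values {V : Type} [Fintype V] {α : V → ℝ} {p q s : ℝ}
    (hpq : p ≠ q) (hps : p ≠ s) (hqs : q ≠ s) (hα : ∀ x, α x = p ∨ α x = q ∨ α x = s)
    (f : V → ℝ) :
    ∑ z, f z = ∑ z with α z = p, f z + ∑ z with α z = q, f z + ∑ z with α z = s, f z := by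
  simp only [Finset.sum_filter, ← Finset.sum_add_distrib]
  refine Finset.sum_congr rfl fun z _ => ?_
  rcases hα z with h | h | h <;> simp [h, hpq, hps, hqs, hpq.symm, hps.symm, hqs.symm]

namespace RankOneSquare

variable {V : Type} [Fintype V] [DecidableEq V] {a : V → V → ℝ} {α : V → ℝ} {σ c θ : ℝ}

/-- Three classes whose quotient is a path `p - q - s` with full blocks between consecutive
classes. -/
theorem no_path_quotient_of_lt (H : RankOneSquare a α σ c θ) {p q s : ℝ} (hpq : p ≠ q)
    (hps : p < s) (hqs : q ≠ s) (hα : ∀ x, α x = p ∨ α x = q ∨ α x = s)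
    {x y z : V} (hx : α x = p) (hy : α y = q) (hz : α z = s)
    (Bpq : ∀ x y, α x = p → α y = q → a x y = 1)
    (Bsq : ∀ x y, α x = s → α y = q → a x y = 1)
    (Bps : ∀ x y, α x = p → α y = s → a x y = 0) : False := by
  have split := sum_eq_sum_three_values hpq hps.ne hqs hα
  have Bqp : ∀ x y, α x = q → α y = p → a x y = 1 := fun x y h h' => by
    rw [H.symm]; exact Bpq y x h' h
  have Bqs : ∀ x y, α x = q → α y = s → a x y = 1 := fun x y h h' => by
    rw [H.symm]; exact Bsq y x h' h
  have Bsp : ∀ x y, α x = s → α y = p → a x y = 0 := fun x y h h' => by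
    rw [H.symm]; exact Bps y x h' h
  have p0 : 0 < p := hx ▸ H.pos x
  have q0 : 0 < q := hy ▸ H.pos y
  have s0 : 0 < s := hz ▸ H.pos z
  have hxz : x ≠ z := by rintro rfl; linarith
  have hxy : x ≠ y := by rintro rfl; exact hpq (hx ▸ hy)
  have hyz : y ≠ z := by rintro rfl; exact hqs (hy ▸ hz)
  obtain ⟨nq, hnq⟩ : ∃ n : ℕ, n = (Finset.univ.filter fun w => α w = q).card := ⟨_, rfl⟩
  have sumq : ∀ f : V → ℝ, ∀ t : ℝ, (∀ w, α w = q → f w = t) →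
      ∑ w with α w = q, f w = nq * t := by
    intro f t hf
    rw [Finset.sum_congr rfl (g := fun _ => t) (by simpa using hf)]
    simp [hnq]
  have sum0 : ∀ f : V → ℝ, ∀ t : ℝ, (∀ w, α w = t → f w = 0) → ∑ w with α w = t, f w = 0 := by
    intro f t hf
    exact Finset.sum_eq_zero (by simpa using hf)
  -- the number of vertices of the middle class
  have hn : (nq : ℝ) = p * s := by
    have h := H.sq x z
    rw [Bps x z hx hz, if_neg hxz, split, sum0 _ p, sum0 _ s, sumq _ 1, hx, hz] at h
    · linarith
    · intro w hw; rw [Bpq x w hx hw, Bqs w z hw hz]; ring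
    · intro w hw; rw [Bps x w hx hw]; ring
    · intro w hw; rw [Bps w z hw hz]; ring
  have clique : ∀ x x', α x = p → α x' = p → x ≠ x' → a x x' = 1 := by
    intro x x' hx hx' hne
    rcases H.zero_or_one x x' with h0 | h0
    · have h := H.sq x x'
      rw [h0, if_neg hne, split, sum0 _ s, sumq _ 1, hx, hx'] at h
      · have : 0 ≤ ∑ w with α w = p, a x w * a w x' :=
          Finset.sum_nonneg fun w _ => mul_nonneg (H.nonneg _ _) (H.nonneg _ _)
        nlinarith
      · intro w hw; rw [Bpq x w hx hw, Bqp w x' hw hx']; ring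
      · intro w hw; rw [Bps x w hx hw]; ring
    · exact h0
  have single_of_clique : ∀ t : ℝ, (∀ x x', α x = t → α x' = t → x ≠ x' → a x x' = 1) →
      (∀ x x' w, α x = t → α x' = t → α w ≠ t → a x w = a x' w) →
      ∀ x x', α x = t → α x' = t → x = x' := by
    intro t h1 h2 u v hu hv
    by_contra hne
    refine H.no_adjacent_twins (u := x) (v := z) (by rw [hx, hz]; exact hps.ne)
      (hu.trans hv.symm) (h1 u v hu hv hne) fun w hwu hwv => ?_
    by_cases hw : α w = t
    · rw [h1 u w hu hw hwu.symm, h1 v w hv hw hwv.symm]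
    · exact h2 u v w hu hv hw
  have single := single_of_clique p clique <| by
    intro u v w hu hv hw
    rcases hα w with h | h | h
    · exact absurd h hw
    · rw [Bpq u w hu h, Bpq v w hv h]
    · rw [Bps u w hu h, Bps v w hv h]
  have sump : ∀ f : V → ℝ, ∑ w with α w = p, f w = f x := by
    intro f
    rw [Finset.sum_eq_single_of_mem x (by simp [hx])]
    intro w hw hne
    exact absurd (single w x (by simpa using hw) hx) hne
  obtain ⟨k, hk⟩ : ∃ k, k = ∑ w with α w = q, a y w := ⟨_, rfl⟩
  obtain ⟨l, hl⟩ : ∃ l, l = ∑ w with α w = s, a z w := ⟨_, rfl⟩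
  obtain ⟨ns, hns⟩ : ∃ n : ℝ, n = ∑ w with α w = s, 1 := ⟨_, rfl⟩
  have k0 : 0 ≤ k := hk ▸ Finset.sum_nonneg fun w _ => H.nonneg _ _
  have cong : ∀ t : ℝ, ∀ f g : V → ℝ, (∀ w, α w = t → f w = g w) →
      ∑ w with α w = t, f w = ∑ w with α w = t, g w := by
    intro t f g h
    exact Finset.sum_congr rfl (by simpa using h)
  have rowx : nq = c + p ^ 2 := by
    have h := H.row_sum x
    rw [split, sump, H.diag, hx, sumq _ 1 fun w hw => Bpq x w hx hw,
      sum0 _ s fun w hw => Bps x w hx hw] at h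
    linarith
  have rowy : 1 + k + ns = c + q ^ 2 := by
    have h := H.row_sum y
    rw [split, sump, Bqp y x hy hx, hy, ← hk, cong s _ _ fun w hw => Bqs y w hy hw, ← hns] at h
    linarith
  have rowz : nq + l = c + s ^ 2 := by
    have h := H.row_sum z
    rw [split, sump, Bsp z x hz hx, hz, ← hl, sumq _ 1 fun w hw => Bsq z w hz hw] at h
    linarith
  have eigx : nq * q = θ * p := by
    have h := H.eig x
    rw [split, sump, H.diag, hx, sumq _ q fun w hw => by rw [Bpq x w hx hw, hw, one_mul],
      sum0 _ s fun w hw => by rw [Bps x w hx hw, zero_mul]] at h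
    linarith
  have eigy : p + k * q + ns * s = θ * q := by
    have h := H.eig y
    rw [split, sump, Bqp y x hy hx, hy, hx, cong q _ (fun w => a y w * q) fun w hw => by rw [hw],
      cong s _ (fun w => 1 * s) fun w hw => by rw [Bqs y w hy hw, hw],
      ← Finset.sum_mul, ← Finset.sum_mul, ← hk, ← hns] at h
    linarith
  have sqxy : k = σ + p * q := by
    have h := H.sq x y
    rw [split, sump, H.diag, hx, hy, Bpq x y hx hy, if_neg hxy,
      cong q _ (fun w => a y w) fun w hw => by rw [Bpq x w hx hw, H.symm w y, one_mul],
      sum0 _ s fun w hw => by rw [Bps x w hx hw, zero_mul], ← hk] at h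
    linarith
  have sqyz : k + l = σ + q * s := by
    have h := H.sq y z
    rw [split, sump, Bps x z hx hz, hy, hz, Bqs y z hy hz, if_neg hyz,
      cong q _ (fun w => a y w) fun w hw => by rw [Bqs w z hw hz, mul_one],
      cong s _ (fun w => a z w) fun w hw => by rw [Bqs y w hy hw, H.symm w z, one_mul],
      ← hk, ← hl] at h
    linarith
  have hc : c = p * (s - p) := by linarith
  have hq : q = s + p := by
    refine mul_left_cancel₀ (sub_ne_zero.2 hps.ne') ?_
    linarith
  have hθ : θ = s * q := mul_right_cancel₀ p0.ne' (by rw [← eigx, hn]; ring)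
  have hkp : k * p = (s - p) * (1 - p * s) := by
    subst hq hθ hc
    linear_combination eigy - s * rowy
  have hps1 : p * s = 1 := by
    have h1 : p * s ≤ 1 := by
      by_contra! h
      nlinarith [mul_nonneg k0 p0.le]
    have h2 : 0 < nq := by
      have : (0 : ℝ) < nq := hn ▸ mul_pos p0 s0
      exact_mod_cast this
    have h3 : (1 : ℝ) ≤ nq := by exact_mod_cast h2
    linarith
  have c0 : 0 < c := hc ▸ mul_pos p0 (by linarith)
  have c1 : c < 1 := by nlinarith
  by_cases hex : ∃ u v, u ≠ v ∧ α u = s ∧ α v = s ∧ a u v = 0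
  · obtain ⟨u, v, hne, hu, hv, h0⟩ := hex
    obtain ⟨m, hm⟩ := H.exists_nat_mul hne h0
    obtain ⟨m', hm'⟩ := H.exists_nat_sum z z
    rw [H.sq, H.diag, if_pos rfl, hz] at hm'
    rw [hu, hv] at hm
    have hcm : c = ((m' - m : ℤ) : ℝ) := by
      push_cast
      linarith
    rw [hcm] at c0 c1
    have h1 : (0 : ℤ) < m' - m := by exact_mod_cast c0
    have h2 : (m' - m : ℤ) < 1 := by exact_mod_cast c1
    omega
  · have single' := single_of_clique s
      (fun u v hu hv hne => (H.zero_or_one u v).resolve_left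
        fun h0 => hex ⟨u, v, hne, hu, hv, h0⟩) <| by
      intro u v w hu hv hw
      rcases hα w with h | h | h
      · rw [Bsp u w hu h, Bsp v w hv h]
      · rw [Bsq u w hu h, Bsq v w hv h]
      · exact absurd h hw
    have hl0 : l = 0 := by
      rw [hl, Finset.sum_eq_single_of_mem z (by simp [hz]), H.diag]
      intro w hw hne
      exact absurd (single' w z (by simpa using hw) hz) hne
    nlinarith

/-- As `no_path_quotient_of_lt`, without the order of the two ends. -/
theorem no_path_quotient (H : RankOneSquare a α σ c θ) {p q s : ℝ} (hpq : p ≠ q)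
    (hps : p ≠ s) (hqs : q ≠ s) (hα : ∀ x, α x = p ∨ α x = q ∨ α x = s)
    {x y z : V} (hx : α x = p) (hy : α y = q) (hz : α z = s)
    (Bpq : ∀ x y, α x = p → α y = q → a x y = 1)
    (Bsq : ∀ x y, α x = s → α y = q → a x y = 1)
    (Bps : ∀ x y, α x = p → α y = s → a x y = 0) : False := by
  rcases lt_or_gt_of_ne hps with h | h
  · exact H.no_path_quotient_of_lt hpq h hqs hα hx hy hz Bpq Bsq Bps
  · refine H.no_path_quotient_of_lt hqs.symm h hpq.symm
      (fun x => by rcases hα x with h | h | h <;> simp [h]) hz hy hx Bsq Bpq fun x y h h' => ?_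
    rw [H.symm]
    exact Bps y x h' h

/-- With three values of `α`, some block between different classes is neither full nor empty. -/
theorem not_all_blocks_constant (H : RankOneSquare a α σ c θ) {p q s : ℝ} (hpq : p ≠ q)
    (hps : p ≠ s) (hqs : q ≠ s) (hα : ∀ x, α x = p ∨ α x = q ∨ α x = s)
    {x y z : V} (hx : α x = p) (hy : α y = q) (hz : α z = s)
    (const : ∀ x y x' y', α x ≠ α y → α x = α x' → α y = α y' → a x y = a x' y') : False := by
  have blk : ∀ u v, α u ≠ α v → ∀ u' v', α u' = α u → α v' = α v → a u' v' = a u v :=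
    fun u v h u' v' h1 h2 => (const u v u' v' h h1.symm h2.symm).symm
  have bpq := blk x y (by rw [hx, hy]; exact hpq)
  have bps := blk x z (by rw [hx, hz]; exact hps)
  have bqs := blk y z (by rw [hy, hz]; exact hqs)
  have hxz : x ≠ z := by rintro rfl; exact hps (hx ▸ hz)
  have hxy : x ≠ y := by rintro rfl; exact hpq (hx ▸ hy)
  have hyz : y ≠ z := by rintro rfl; exact hqs (hy ▸ hz)
  rw [hx, hy] at bpq
  rw [hx, hz] at bps
  rw [hy, hz] at bqs
  -- an empty block forces the other two to be full
  have common : ∀ {p q s : ℝ}, p ≠ q → (∀ x, α x = p ∨ α x = q ∨ α x = s) →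
      (∀ u v, α u = p → α v = q → a u v = 0) → ∀ x y, α x = p → α y = q →
      ∃ w, α w = s ∧ a x w = 1 ∧ a w y = 1 := by
    intro p q s hpq hα h0 x y hx hy
    obtain ⟨w, h1, h2⟩ := H.exists_common (x := x) (y := y)
      (by rintro rfl; exact hpq (hx ▸ hy)) (h0 x y hx hy)
    refine ⟨w, ?_, h1, h2⟩
    rcases hα w with h | h | h
    · rw [h0 w y h hy] at h2
      norm_num at h2
    · rw [h0 x w hx h] at h1
      norm_num at h1
    · exact h
  rcases H.zero_or_one x y with h12 | h12
  · rw [h12] at bpq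
    obtain ⟨w, hw, h1, h2⟩ := common hpq hα bpq x y hx hy
    refine H.no_path_quotient hps hpq hqs.symm
      (fun x => by rcases hα x with h | h | h <;> simp [h]) hx hz hy ?_ ?_ bpq
    · intro u v hu hv
      rw [bps u v hu hv, ← bps x w hx hw, h1]
    · intro u v hu hv
      rw [bqs u v hu hv, ← bqs y w hy hw, H.symm, h2]
  rcases H.zero_or_one x z with h13 | h13
  · rw [h13] at bps
    obtain ⟨w, hw, h1, h2⟩ := common (s := q) hps
      (fun x => by rcases hα x with h | h | h <;> simp [h]) bps x z hx hz
    refine H.no_path_quotient hpq hps hqs hα hx hy hz ?_ ?_ bps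
    · intro u v hu hv
      rw [bpq u v hu hv, h12]
    · intro u v hu hv
      rw [H.symm, bqs v u hv hu, ← bqs w z hw hz, h2]
  rcases H.zero_or_one y z with h23 | h23
  · rw [h23] at bqs
    refine H.no_path_quotient hpq.symm hqs hps
      (fun x => by rcases hα x with h | h | h <;> simp [h]) hy hx hz ?_ ?_ bqs
    · intro u v hu hv
      rw [H.symm, bpq v u hv hu, h12]
    · intro u v hu hv
      rw [H.symm, bps v u hv hu, h13]
  rw [h12] at bpq
  rw [h13] at bps
  rw [h23] at bqs
  refine H.no_covering_triple (x := x) (y := y) (z := z) (by rw [hx, hz]; exact hps)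
    (by rw [hy, hz]; exact hqs) h12 h13 h23 ?_ ?_ ?_ <;> intro w <;> rcases hα w with h | h | h
  · right; rw [H.symm]; exact bpq w y h hy
  · left; exact bpq x w hx h
  · left; exact bps x w hx h
  · right; rw [H.symm]; exact bps w z h hz
  · left; exact bpq x w hx h
  · left; exact bps x w hx h
  · left; rw [H.symm]; exact bpq w y h hy
  · right; rw [H.symm]; exact bqs w z h hz
  · left; exact bqs y w hy h

end RankOneSquare

/-- Two positive reals with product `1` and integral squares are equal. -/
theorem eq_of_mul_eq_one_of_sq_int {x y : ℝ} (hx : 0 < x) (hy : 0 < y) (h : x * y = 1)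
    (hx2 : ∃ m : ℤ, x ^ 2 = m) (hy2 : ∃ m : ℤ, y ^ 2 = m) : x = y := by
  obtain ⟨m, hm⟩ := hx2
  obtain ⟨n, hn⟩ := hy2
  have hm0 : 0 < m := by
    have : (0 : ℝ) < m := hm ▸ pow_pos hx 2
    exact_mod_cast this
  have hmn : m * n = 1 := by
    have : (m : ℝ) * n = 1 := by rw [← hm, ← hn, ← mul_pow, h, one_pow]
    exact_mod_cast this
  have hm1 : m = 1 := Int.eq_one_of_mul_eq_one_right hm0.le hmn
  have hn1 : n = 1 := by simpa [hm1] using hmn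
  rw [hm1] at hm
  rw [hn1] at hn
  exact (pow_left_inj₀ hx.le hy.le two_ne_zero).1 (by rw [hm, hn])

theorem design_quotient_arith_aux {e₁ e₂ f₁ f₂ n₁ n₂ r k p u v σ c : ℝ}
    (he₁ : e₁ = 0 ∨ e₁ = 1) (he₂ : e₂ = 0 ∨ e₂ = 1) (hf₁ : f₁ = 0 ∨ f₁ = 1)
    (hf₂ : f₂ = 0 ∨ f₂ = 1) (hle : e₂ ≤ e₁) (hle' : e₁ = e₂ → f₂ ≤ f₁)
    (hp : 0 < p) (hu : 0 < u) (hv : 0 < v) (hpu : p ≠ u) (hpv : p ≠ v) (huv : u ≠ v)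
    (hk : 0 < k) (hr : 0 < r) (hkn : k ≤ n₁)
    (row₀ : f₁ * n₁ + f₂ * n₂ = c + p ^ 2)
    (row₁ : e₁ * (n₁ - 1) + r + f₁ = c + u ^ 2)
    (row₂ : e₂ * (n₂ - 1) + k + f₂ = c + v ^ 2)
    (hσ : σ = -(e₁ + e₂)) (sq₁₂ : u * v = e₁ * k + e₂ * r + f₁ * f₂)
    (sq₀₁ : f₁ * e₁ * (n₁ - 1) + f₂ * r = f₁ * σ + p * u)
    (sq₀₂ : f₂ * e₂ * (n₂ - 1) + f₁ * k = f₂ * σ + p * v)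
    (iu : e₁ = 0 → ∃ m : ℤ, u ^ 2 = m) (iv : e₂ = 0 → ∃ m : ℤ, v ^ 2 = m)
    (ipv : ∃ m : ℤ, p ^ 2 - v ^ 2 = m) : False := by
  have huv0 := mul_pos hu hv
  have hpu0 := mul_pos hp hu
  have hpv0 := mul_pos hp hv
  rcases he₁ with rfl | rfl <;> rcases he₂ with rfl | rfl
  · rcases hf₁ with rfl | rfl <;> rcases hf₂ with rfl | rfl
    · linarith
    · norm_num at hle'
    · linarith
    · exact huv (eq_of_mul_eq_one_of_sq_int hu hv (by linarith) (iu rfl) (iv rfl))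
  · norm_num at hle
  · rcases hf₁ with rfl | rfl <;> rcases hf₂ with rfl | rfl
    · linarith
    · obtain ⟨m, hm⟩ := ipv
      obtain ⟨m', hm'⟩ := iv rfl
      refine hpv (eq_of_mul_eq_one_of_sq_int hp hv (by linarith) ⟨m + m', ?_⟩ ⟨m', hm'⟩)
      push_cast
      linarith
    · exact hpu (mul_right_cancel₀ hv.ne' (by linarith))
    · exact hpu (mul_right_cancel₀ hv.ne' (by linarith))
  · rcases hf₁ with rfl | rfl <;> rcases hf₂ with rfl | rfl
    · linarith
    · norm_num at hle'
    · have h1 : p * u = n₁ + 1 := by linarith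
      have h2 : p * v = k := by linarith
      have h3 : u * v = k + r := by linarith
      have h4 : u ^ 2 = r + p ^ 2 := by linarith
      have h5 : p ^ 2 * (k + r) = k * (n₁ + 1) := by
        rw [← h1, ← h3, ← h2]
        ring
      have h6 : (n₁ + 1) ^ 2 = p ^ 2 * r + p ^ 2 * p ^ 2 := by
        rw [← h1, mul_pow, h4]
        ring
      have h7 : (n₁ + 1) * (k + r) ^ 2 = k * r * (k + r) + k ^ 2 * (n₁ + 1) := by
        have hn : n₁ + 1 ≠ 0 := by linarith
        refine mul_left_cancel₀ hn ?_
        linear_combination (k + r) ^ 2 * h6 + (r * (k + r) + p ^ 2 * (k + r) + k * (n₁ + 1)) * h5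
      have h8 : 0 < r * (k + r) := by positivity
      nlinarith [mul_pos hk hr]
    · have h1 : u + v = p := by
        refine mul_right_cancel₀ (sub_ne_zero.2 huv) ?_
        linarith
      have h2 : u ^ 2 + v ^ 2 = p ^ 2 := by
        subst h1
        nlinarith
      rw [← h1] at h2
      linarith

theorem design_quotient_arith {e₁ e₂ f₁ f₂ n₁ n₂ r k p u v σ c : ℝ}
    (he₁ : e₁ = 0 ∨ e₁ = 1) (he₂ : e₂ = 0 ∨ e₂ = 1) (hf₁ : f₁ = 0 ∨ f₁ = 1)
    (hf₂ : f₂ = 0 ∨ f₂ = 1)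
    (hp : 0 < p) (hu : 0 < u) (hv : 0 < v) (hpu : p ≠ u) (hpv : p ≠ v) (huv : u ≠ v)
    (hk : 0 < k) (hr : 0 < r) (hkn : k ≤ n₁) (hrn : r ≤ n₂)
    (row₀ : f₁ * n₁ + f₂ * n₂ = c + p ^ 2)
    (row₁ : e₁ * (n₁ - 1) + r + f₁ = c + u ^ 2)
    (row₂ : e₂ * (n₂ - 1) + k + f₂ = c + v ^ 2)
    (hσ : σ = -(e₁ + e₂)) (sq₁₂ : u * v = e₁ * k + e₂ * r + f₁ * f₂)
    (sq₀₁ : f₁ * e₁ * (n₁ - 1) + f₂ * r = f₁ * σ + p * u)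
    (sq₀₂ : f₂ * e₂ * (n₂ - 1) + f₁ * k = f₂ * σ + p * v)
    (iu : e₁ = 0 → ∃ m : ℤ, u ^ 2 = m) (iv : e₂ = 0 → ∃ m : ℤ, v ^ 2 = m)
    (ipu : ∃ m : ℤ, p ^ 2 - u ^ 2 = m) (ipv : ∃ m : ℤ, p ^ 2 - v ^ 2 = m) : False := by
  by_cases h : e₂ ≤ e₁ ∧ (e₁ = e₂ → f₂ ≤ f₁)
  · exact design_quotient_arith_aux he₁ he₂ hf₁ hf₂ h.1 h.2 hp hu hv hpu hpv huv hk hr hkn row₀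
      row₁ row₂ hσ sq₁₂ sq₀₁ sq₀₂ iu iv ipv
  · refine design_quotient_arith_aux he₂ he₁ hf₂ hf₁ ?_ ?_ hp hv hu hpv hpu huv.symm hr hk hrn
      (by linarith) row₂ row₁ (by linarith) (by linarith) sq₀₂ sq₀₁ iv iu ipu
    · by_contra! h'
      exact h ⟨h'.le, fun h'' => absurd h'' h'.ne'⟩
    · intro h'
      by_contra! h''
      exact h ⟨h'.le, fun _ => h''.le⟩

namespace RankOneSquare

variable {V : Type} [Fintype V] [DecidableEq V] {a : V → V → ℝ} {α : V → ℝ} {σ c θ : ℝ}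

/-- There is no equitable three-class quotient with a singleton class, two classes that are
cliques or cocliques, full or empty blocks at the singleton, and a mixed remaining block. -/
theorem no_design_quotient (H : RankOneSquare a α σ c θ) {p u v : ℝ} (hpu : p ≠ u)
    (hpv : p ≠ v) (huv : u ≠ v) (hα : ∀ x, α x = u ∨ α x = v ∨ α x = p)
    {o : V} (ho : α o = p) (single : ∀ w, α w = p → w = o) {e₁ e₂ f₁ f₂ r k : ℝ}
    (hf₁ : ∀ x, α x = u → a o x = f₁) (hf₂ : ∀ x, α x = v → a o x = f₂)
    (he₁ : ∀ x x', α x = u → α x' = u → x ≠ x' → a x x' = e₁)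
    (he₂ : ∀ x x', α x = v → α x' = v → x ≠ x' → a x x' = e₂)
    (hr : ∀ x, α x = u → ∑ w with α w = v, a x w = r)
    (hk : ∀ y, α y = v → ∑ w with α w = u, a y w = k)
    {x y x' y' : V} (hx : α x = u) (hy : α y = v) (hx' : α x' = u) (hy' : α y' = v)
    (hxy : a x y = 1) (hxy' : a x' y' = 0) : False := by
  have split := sum_eq_sum_three_values huv hpu.symm hpv.symm hα
  have sumo : ∀ f : V → ℝ, ∑ w with α w = p, f w = f o := by
    intro f
    rw [Finset.sum_eq_single_of_mem o (by simp [ho])]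
    intro w hw hne
    exact absurd (single w (by simpa using hw)) hne
  have cong : ∀ t : ℝ, ∀ f g : V → ℝ, (∀ w, α w = t → f w = g w) →
      ∑ w with α w = t, f w = ∑ w with α w = t, g w := by
    intro t f g h
    exact Finset.sum_congr rfl (by simpa using h)
  obtain ⟨n, hn⟩ : ∃ n : ℝ → ℝ, ∀ t, ∑ w with α w = t, (1 : ℝ) = n t := ⟨_, fun _ => rfl⟩
  have inner : ∀ t e, (∀ x x', α x = t → α x' = t → x ≠ x' → a x x' = e) → ∀ x, α x = t →
      ∀ g : V → ℝ, ∑ w with α w = t, a x w * g w = e * (∑ w with α w = t, g w - g x) := by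
    intro t e he x hx g
    rw [cong t _ (fun w => e * g w - if w = x then e * g w else 0), Finset.sum_sub_distrib,
      ← Finset.mul_sum, Finset.sum_ite_eq', if_pos (by simp [hx]), mul_sub]
    intro w hw
    split_ifs with h
    · subst h
      simp [H.diag]
    · rw [he x w hx hw (Ne.symm h), sub_zero]
  have kpos : ∀ {t t' k : ℝ}, (∀ y, α y = t → ∑ w with α w = t', a y w = k) → ∀ x y, α x = t →
      α y = t' → a x y = 1 → 0 < k := by
    intro t t' k hk x y hx hy h
    rw [← hk x hx]
    refine Finset.sum_pos' (fun w _ => H.nonneg _ _) ⟨y, by simp [hy], by rw [h]; norm_num⟩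
  have hk0 : 0 < k := kpos hk y x hy hx (by rwa [H.symm])
  have hr0 : 0 < r := kpos hr x y hx hy hxy
  have le_n : ∀ t x, ∑ w with α w = t, a x w ≤ n t := fun t x => by
    rw [← hn]
    exact Finset.sum_le_sum fun w _ => H.le_one _ _
  have exists_ne : ∀ {t t' k : ℝ}, (∀ y, α y = t → ∑ w with α w = t', a y w = k) → 0 < k →
      ∀ x y, α x = t → a x y = 0 → ∃ w, α w = t' ∧ y ≠ w := by
    intro t t' k hk hk0 x y hx h
    by_contra! hc
    rw [← hk x hx, Finset.sum_eq_zero] at hk0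
    · exact lt_irrefl _ hk0
    · intro w hw
      rw [← hc w (by simpa using hw), h]
  have sq_int : ∀ {t e : ℝ}, (∀ x x', α x = t → α x' = t → x ≠ x' → a x x' = e) →
      (∃ x x', α x = t ∧ α x' = t ∧ x ≠ x') → (e = 0 ∨ e = 1) ∧ (e = 0 → ∃ m : ℤ, t ^ 2 = m) := by
    rintro t e he ⟨x, x', hx, hx', hne⟩
    refine ⟨he x x' hx hx' hne ▸ H.zero_or_one x x', fun h0 => ?_⟩
    obtain ⟨m, hm⟩ := H.exists_nat_mul hne (by rw [he x x' hx hx' hne, h0])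
    refine ⟨m, ?_⟩
    rw [hx, hx', ← pow_two] at hm
    exact_mod_cast hm
  have sq_sub_int : ∀ x y, ∃ m : ℤ, α x ^ 2 - α y ^ 2 = m := by
    intro x y
    obtain ⟨m, hm⟩ := H.exists_nat_sum x x
    obtain ⟨m', hm'⟩ := H.exists_nat_sum y y
    rw [H.sq, H.diag, if_pos rfl] at hm hm'
    refine ⟨m - m', ?_⟩
    push_cast
    linarith
  obtain ⟨he₁', iu⟩ := sq_int he₁ (by
    obtain ⟨w, hw, hne⟩ := exists_ne hk hk0 y' x' hy' (by rwa [H.symm])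
    exact ⟨x', w, hx', hw, hne⟩)
  obtain ⟨he₂', iv⟩ := sq_int he₂ (by
    obtain ⟨w, hw, hne⟩ := exists_ne hr hr0 x' y' hx' hxy'
    exact ⟨y', w, hy', hw, hne⟩)
  have row₀ : f₁ * n u + f₂ * n v = c + p ^ 2 := by
    have h := H.row_sum o
    rw [split, sumo, H.diag, ho, cong u _ (fun w => f₁ * 1) fun w hw => by rw [hf₁ w hw, mul_one],
      cong v _ (fun w => f₂ * 1) fun w hw => by rw [hf₂ w hw, mul_one], ← Finset.mul_sum,
      ← Finset.mul_sum, hn, hn] at h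
    linarith
  have row₁ : e₁ * (n u - 1) + r + f₁ = c + u ^ 2 := by
    have h := H.row_sum x
    have h1 := inner u e₁ he₁ x hx 1
    simp only [Pi.one_apply, mul_one] at h1
    rw [split, sumo, hx, h1, hn, hr x hx, H.symm, hf₁ x hx] at h
    linarith
  have row₂ : e₂ * (n v - 1) + k + f₂ = c + v ^ 2 := by
    have h := H.row_sum y
    have h1 := inner v e₂ he₂ y hy 1
    simp only [Pi.one_apply, mul_one] at h1
    rw [split, sumo, hy, h1, hn, hk y hy, H.symm, hf₂ y hy] at h
    linarith
  have sq₁₂ : ∀ x y, α x = u → α y = v →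
      e₁ * (k - a x y) + e₂ * (r - a x y) + f₁ * f₂ = σ * a x y + u * v := by
    intro x y hx hy
    have h := H.sq x y
    have h1 := inner u e₁ he₁ x hx fun w => a w y
    have h2 := inner v e₂ he₂ y hy fun w => a x w
    have h3 : ∑ w with α w = u, a w y = k := by
      rw [← hk y hy]
      exact Finset.sum_congr rfl fun w _ => H.symm _ _
    have h4 : ∑ w with α w = v, a x w * a w y = ∑ w with α w = v, a y w * a x w :=
      Finset.sum_congr rfl fun w _ => by rw [H.symm w y, mul_comm]
    rw [split, sumo, h1, h3, h4, h2, hr x hx, hx, hy, H.symm x o, hf₁ x hx, hf₂ y hy,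
      if_neg (by rintro rfl; exact huv (hx ▸ hy))] at h
    linarith
  have sq₀₁ : f₁ * e₁ * (n u - 1) + f₂ * r = f₁ * σ + p * u := by
    have h := H.sq o x
    have h1 := inner u e₁ he₁ x hx 1
    simp only [Pi.one_apply, mul_one] at h1
    rw [split, sumo, H.diag, cong u _ (fun w => f₁ * a x w) fun w hw => by rw [hf₁ w hw, H.symm x w],
      cong v _ (fun w => f₂ * a x w) fun w hw => by rw [hf₂ w hw, H.symm x w], ← Finset.mul_sum,
      ← Finset.mul_sum, h1, hn, hr x hx, hf₁ x hx, ho, hx,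
      if_neg (by rintro rfl; exact hpu (ho ▸ hx))] at h
    linarith
  have sq₀₂ : f₂ * e₂ * (n v - 1) + f₁ * k = f₂ * σ + p * v := by
    have h := H.sq o y
    have h1 := inner v e₂ he₂ y hy 1
    simp only [Pi.one_apply, mul_one] at h1
    rw [split, sumo, H.diag, cong u _ (fun w => f₁ * a y w) fun w hw => by rw [hf₁ w hw, H.symm y w],
      cong v _ (fun w => f₂ * a y w) fun w hw => by rw [hf₂ w hw, H.symm y w], ← Finset.mul_sum,
      ← Finset.mul_sum, h1, hn, hk y hy, hf₂ y hy, ho, hy,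
      if_neg (by rintro rfl; exact hpv (ho ▸ hy))] at h
    linarith
  have s1 := sq₁₂ x y hx hy
  have s0 := sq₁₂ x' y' hx' hy'
  rw [hxy] at s1
  rw [hxy'] at s0
  refine design_quotient_arith he₁' he₂' (hf₁ x hx ▸ H.zero_or_one o x)
    (hf₂ y hy ▸ H.zero_or_one o y) (ho ▸ H.pos o) (hx ▸ H.pos x) (hy ▸ H.pos y) hpu hpv huv hk0 hr0
    (hk y hy ▸ le_n u y) (hr x hx ▸ le_n v x) row₀ row₁ row₂ (by linarith) (by linarith) sq₀₁ sq₀₂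
    iu iv ?_ ?_
  · rw [← ho, ← hx]
    exact sq_sub_int o x
  · rw [← ho, ← hy]
    exact sq_sub_int o y

end RankOneSquare

theorem isHermitian_adjMatrix {V : Type} (G : SimpleGraph V) [DecidableRel G.Adj] :
    (G.adjMatrix ℝ).IsHermitian := by
  rw [Matrix.IsHermitian, Matrix.conjTranspose_eq_transpose_of_trivial]
  exact G.isSymm_adjMatrix

section Spectral

variable {V : Type} [Fintype V] [DecidableEq V] {G : SimpleGraph V} [DecidableRel G.Adj]
  {θ0 θ1 θ2 : ℝ}

theorem Matrix.IsHermitian.eigenvectorBasis_ne_zero {M : Matrix V V ℝ} (hM : M.IsHermitian)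
    (j : V) : (⇑(hM.eigenvectorBasis j) : V → ℝ) ≠ 0 := by
  intro h0
  have h1 := hM.eigenvectorBasis.orthonormal.ne_zero j
  exact h1 (by ext i; exact congrFun h0 i)

theorem adjMatrix_cubic (h : InG3 G θ0 θ1 θ2) :
    (G.adjMatrix ℝ - θ0 • 1) * ((G.adjMatrix ℝ - θ1 • 1) * (G.adjMatrix ℝ - θ2 • 1)) = 0 := by
  have hM := isHermitian_adjMatrix G
  set M := G.adjMatrix ℝ
  set P := (M - θ0 • 1) * ((M - θ1 • 1) * (M - θ2 • 1))
  have hcol : ∀ j, P *ᵥ ⇑(hM.eigenvectorBasis j) = 0 := by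
    intro j
    have he := hM.mulVec_eigenvectorBasis j
    have hmem : hM.eigenvalues j ∈ ({θ0, θ1, θ2} : Set ℝ) := by
      rw [← h.2.2.2]
      exact ⟨_, hM.eigenvectorBasis_ne_zero j, he⟩
    have hsub : ∀ t : ℝ, (M - t • (1 : Matrix V V ℝ)) *ᵥ ⇑(hM.eigenvectorBasis j) =
        (hM.eigenvalues j - t) • ⇑(hM.eigenvectorBasis j) := by
      intro t
      rw [Matrix.sub_mulVec, he, Matrix.smul_mulVec, Matrix.one_mulVec, sub_smul]
    simp only [P, ← Matrix.mulVec_mulVec, hsub, Matrix.mulVec_smul, smul_smul]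
    rcases hmem with e | e | e <;> rw [e] <;> simp
  have hU : P * (hM.eigenvectorUnitary : Matrix V V ℝ) = 0 := by
    ext i j
    exact congrFun (hcol j) i
  calc P = P * ((hM.eigenvectorUnitary : Matrix V V ℝ) *
        star (hM.eigenvectorUnitary : Matrix V V ℝ)) := by
        rw [Matrix.mem_unitaryGroup_iff.1 hM.eigenvectorUnitary.2, mul_one]
    _ = 0 := by rw [← mul_assoc, hU, zero_mul]

theorem posSemidef_sub_adjMatrix (h : InG3 G θ0 θ1 θ2) :
    (θ0 • 1 - G.adjMatrix ℝ).PosSemidef := by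
  have hN : (θ0 • 1 - G.adjMatrix ℝ).IsHermitian := by
    refine Matrix.IsHermitian.sub ?_ (isHermitian_adjMatrix G)
    rw [Matrix.IsHermitian, Matrix.conjTranspose_smul, Matrix.conjTranspose_one, star_trivial]
  rw [hN.posSemidef_iff_eigenvalues_nonneg]
  intro j
  have he := hN.mulVec_eigenvectorBasis j
  rw [Matrix.sub_mulVec, Matrix.smul_mulVec, Matrix.one_mulVec] at he
  have hmem : θ0 - hN.eigenvalues j ∈ ({θ0, θ1, θ2} : Set ℝ) := by
    rw [← h.2.2.2]
    refine ⟨_, hN.eigenvectorBasis_ne_zero j, ?_⟩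
    rw [sub_smul, ← he, sub_sub_cancel]
  have := h.2.1
  have := h.2.2.1
  simp only [Set.mem_insert_iff, Set.mem_singleton_iff] at hmem
  simp only [Pi.zero_apply]
  rcases hmem with e | e | e <;> linarith

/-- Eigenvectors for the largest eigenvalue have no zero entry, and their entrywise absolute
values are again eigenvectors. -/
theorem abs_eigenvector (h : InG3 G θ0 θ1 θ2) {f : V → ℝ} (hf : f ≠ 0)
    (he : G.adjMatrix ℝ *ᵥ f = θ0 • f) :
    G.adjMatrix ℝ *ᵥ (fun x => |f x|) = θ0 • (fun x => |f x|) ∧ ∀ x, f x ≠ 0 := by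
  have hN := posSemidef_sub_adjMatrix h
  have h1 : G.adjMatrix ℝ *ᵥ (fun x => |f x|) = θ0 • (fun x => |f x|) := by
    have h0 : (fun x => |f x|) ⬝ᵥ (θ0 • 1 - G.adjMatrix ℝ) *ᵥ (fun x => |f x|) ≤
        f ⬝ᵥ (θ0 • 1 - G.adjMatrix ℝ) *ᵥ f := by
      simp only [Matrix.sub_mulVec, Matrix.smul_mulVec, Matrix.one_mulVec, dotProduct,
        Pi.sub_apply, Pi.smul_apply, smul_eq_mul, mul_sub, Finset.sum_sub_distrib]
      refine sub_le_sub (le_of_eq (Finset.sum_congr rfl fun x _ => ?_))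
        (Finset.sum_le_sum fun x _ => ?_)
      · rw [mul_left_comm, abs_mul_abs_self, mul_left_comm]
      · rw [SimpleGraph.adjMatrix_mulVec_apply, SimpleGraph.adjMatrix_mulVec_apply]
        calc f x * ∑ u ∈ G.neighborFinset x, f u ≤ |f x| * |∑ u ∈ G.neighborFinset x, f u| := by
              rw [← abs_mul]
              exact le_abs_self _
          _ ≤ _ := mul_le_mul_of_nonneg_left (Finset.abs_sum_le_sum_abs _ _) (abs_nonneg _)
    have h2 : (θ0 • 1 - G.adjMatrix ℝ) *ᵥ f = 0 := by
      rw [Matrix.sub_mulVec, Matrix.smul_mulVec, Matrix.one_mulVec, he, sub_self]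
    rw [h2, dotProduct_zero] at h0
    have h3 := (hN.dotProduct_mulVec_zero_iff _).1
      (le_antisymm (by simpa using h0) (hN.dotProduct_mulVec_nonneg fun x => |f x|))
    rw [Matrix.sub_mulVec, Matrix.smul_mulVec, Matrix.one_mulVec] at h3
    exact (sub_eq_zero.1 h3).symm
  refine ⟨h1, fun x hx => hf ?_⟩
  have step : ∀ x y, G.Adj x y → f x = 0 → f y = 0 := by
    intro x y hxy hx
    have h2 := congrFun h1 x
    rw [SimpleGraph.adjMatrix_mulVec_apply, Pi.smul_apply, hx, abs_zero, smul_zero,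
      Finset.sum_eq_zero_iff_of_nonneg fun _ _ => abs_nonneg _] at h2
    exact abs_eq_zero.1 (h2 y (by simpa using hxy))
  funext y
  obtain ⟨w⟩ := h.1.preconnected x y
  induction w with
  | nil => exact hx
  | cons hadj _ ih => exact ih (step _ _ hadj hx)

theorem InG3.exists_rankOneSquare (h : InG3 G θ0 θ1 θ2) :
    ∃ α σ c θ, RankOneSquare (fun x y => G.adjMatrix ℝ x y) α σ c θ := by
  have cubic := adjMatrix_cubic h
  obtain ⟨f, hf, hfe⟩ : adjEig G θ0 := by
    change θ0 ∈ {θ : ℝ | adjEig G θ}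
    rw [h.2.2.2]
    simp
  obtain ⟨hue, hf0⟩ := abs_eigenvector h hf hfe
  obtain ⟨u, hu⟩ : ∃ u : V → ℝ, u = fun x => |f x| := ⟨_, rfl⟩
  rw [← hu] at hue
  have upos : ∀ x, 0 < u x := fun x => hu ▸ abs_pos.2 (hf0 x)
  obtain ⟨B, hB⟩ : ∃ B, B = (G.adjMatrix ℝ - θ1 • 1) * (G.adjMatrix ℝ - θ2 • 1) := ⟨_, rfl⟩
  rw [← hB] at cubic
  obtain ⟨x0⟩ := h.1.nonempty
  have multiple : ∀ g : V → ℝ, G.adjMatrix ℝ *ᵥ g = θ0 • g → ∀ x y, u y * g x = g y * u x := by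
    intro g hg x y
    have h1 : G.adjMatrix ℝ *ᵥ (u y • g - g y • u) = θ0 • (u y • g - g y • u) := by
      rw [Matrix.mulVec_sub, Matrix.mulVec_smul, Matrix.mulVec_smul, hg, hue, smul_sub,
        smul_comm θ0, smul_comm θ0]
    by_contra hne
    refine (abs_eigenvector h (f := u y • g - g y • u) ?_ h1).2 y ?_
    · intro h2
      have h3 := congrFun h2 x
      simp only [Pi.sub_apply, Pi.smul_apply, smul_eq_mul, Pi.zero_apply] at h3
      exact hne (sub_eq_zero.1 h3)
    · simp only [Pi.sub_apply, Pi.smul_apply, smul_eq_mul]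
      ring
  have colB : ∀ y, G.adjMatrix ℝ *ᵥ (fun x => B x y) = θ0 • (fun x => B x y) := by
    intro y
    rw [sub_mul, smul_mul_assoc, one_mul, sub_eq_zero] at cubic
    funext x
    exact congrFun (congrFun cubic x) y
  have hBapp : ∀ x y, B x y = ∑ z, G.adjMatrix ℝ x z * G.adjMatrix ℝ z y -
      (θ1 + θ2) * G.adjMatrix ℝ x y + θ1 * θ2 * (if x = y then 1 else 0) := by
    intro x y
    rw [← Matrix.mul_apply, ← Matrix.one_apply]
    have : B = G.adjMatrix ℝ * G.adjMatrix ℝ - (θ1 + θ2) • G.adjMatrix ℝ + (θ1 * θ2) • 1 := by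
      rw [hB, sub_mul, mul_sub, mul_sub, add_smul, mul_smul]
      simp only [smul_mul_assoc, mul_smul_comm, one_mul, mul_one]
      module
    rw [this]
    simp only [Matrix.add_apply, Matrix.sub_apply, Matrix.smul_apply, smul_eq_mul]
  have symB : ∀ x y, B x y = B y x := by
    intro x y
    have hs : ∀ x y, G.adjMatrix ℝ x y = G.adjMatrix ℝ y x := fun x y =>
      (G.isSymm_adjMatrix (α := ℝ)).apply y x
    rw [hBapp, hBapp, hs x y]
    congr 1
    · congr 1
      exact Finset.sum_congr rfl fun z _ => by rw [hs x z, hs z y, mul_comm]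
    · simp only [eq_comm]
  obtain ⟨κ, hκ⟩ : ∃ κ, κ = B x0 x0 / (u x0 * u x0) := ⟨_, rfl⟩
  have hBκ : ∀ x y, B x y = κ * (u x * u y) := by
    intro x y
    have h1 : u x0 * B x y = B x0 y * u x := multiple _ (colB y) x x0
    have h2 : u x0 * B y x0 = B x0 x0 * u y := multiple _ (colB x0) y x0
    rw [symB y x0] at h2
    have := (upos x0).ne'
    rw [hκ]
    field_simp
    linear_combination u x0 * h1 + u x * h2
  have hBu : B *ᵥ u = ((θ0 - θ1) * (θ0 - θ2)) • u := by
    rw [hB, ← Matrix.mulVec_mulVec]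
    simp only [Matrix.sub_mulVec, Matrix.smul_mulVec, Matrix.one_mulVec, hue, ← sub_smul,
      Matrix.mulVec_smul, smul_smul]
    rw [mul_comm]
  have κpos : 0 < κ := by
    have h1 := congrFun hBu x0
    simp only [Matrix.mulVec, dotProduct, hBκ, Pi.smul_apply, smul_eq_mul] at h1
    have h2 : 0 < (θ0 - θ1) * (θ0 - θ2) * u x0 :=
      mul_pos (mul_pos (by linarith [h.2.1]) (by linarith [h.2.1, h.2.2.1])) (upos x0)
    rw [← h1] at h2
    by_contra! hκ0
    refine absurd h2 (not_lt.2 (Finset.sum_nonpos fun z _ => ?_))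
    exact mul_nonpos_of_nonpos_of_nonneg
      (mul_nonpos_of_nonpos_of_nonneg hκ0 (mul_pos (upos _) (upos _)).le) (upos z).le
  refine ⟨fun x => √κ * u x, θ1 + θ2, -(θ1 * θ2), θ0, ?_, ?_, ?_, ?_, ?_, ?_⟩
  · intro x y
    by_cases hxy : G.Adj x y <;> simp [hxy]
  · intro x y
    exact (G.isSymm_adjMatrix (α := ℝ)).apply y x
  · simp
  · intro x
    exact mul_pos (Real.sqrt_pos.2 κpos) (upos x)
  · intro x y
    have h1 := hBapp x y
    rw [hBκ] at h1
    have h2 := Real.mul_self_sqrt κpos.le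
    linear_combination -h1 - u x * u y * h2
  · intro x
    have h1 := congrFun hue x
    simp only [Matrix.mulVec, dotProduct, Pi.smul_apply, smul_eq_mul] at h1
    rw [mul_left_comm, ← h1, Finset.mul_sum]
    exact Finset.sum_congr rfl fun z _ => by ring

end Spectral

/-- A colouring of ordered pairs whose colour classes form a coherent configuration: colours
separate the diagonal, and the functions that are constant on colours are closed under the matrix
product. -/
structure IsCoherentColoring {V : Type} [Fintype V] {r : ℕ} (col : V × V → Fin r) : Prop where
  diag : ∀ {x y z : V}, col (x, x) = col (y, z) → y = z
  mul : ∀ {F K : V × V → ℝ}, F.FactorsThrough col → K.FactorsThrough col →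
    (fun q : V × V => ∑ z, F (q.1, z) * K (z, q.2)).FactorsThrough col

theorem mem_span_range_iff_factorsThrough {V : Type} {r : ℕ} {A : Fin r → Matrix V V ℝ}
    {col : V × V → Fin r}
    (hcol : ∀ i x y, A i x y = if i = col (x, y) then 1 else 0) {M : Matrix V V ℝ} :
    M ∈ Submodule.span ℝ (Set.range A) ↔
      (fun q : V × V => M q.1 q.2).FactorsThrough col := by
  rw [Submodule.mem_span_range_iff_exists_fun, Function.factorsThrough_iff]
  have hval : ∀ (g : Fin r → ℝ) x y, (∑ i, g i • A i) x y = g (col (x, y)) := by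
    intro g x y
    simp [Matrix.sum_apply, hcol]
  refine exists_congr fun g => ⟨?_, fun h => ?_⟩
  · rintro rfl
    exact funext fun q => hval g q.1 q.2
  · ext x y
    rw [hval]
    exact (congrFun h (x, y)).symm

namespace IsCoherentConfig

variable {V : Type} [Fintype V] [DecidableEq V] {r : ℕ} {A : Fin r → Matrix V V ℝ}

theorem exists_color (hA : IsCoherentConfig A) :
    ∃ col : V × V → Fin r, ∀ i x y, A i x y = if i = col (x, y) then 1 else 0 := by
  have h : ∀ q : V × V, ∃ j, ∀ i, A i q.1 q.2 = if i = j then 1 else 0 := by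
    intro q
    have hsum : ∑ i, A i q.1 q.2 = 1 := by
      have := congrFun (congrFun hA.2.1 q.1) q.2
      rwa [Matrix.sum_apply] at this
    obtain ⟨j, hj⟩ : ∃ j, A j q.1 q.2 = 1 := by
      by_contra! hne
      rw [Finset.sum_eq_zero fun i _ => (hA.1 i q.1 q.2).resolve_right (hne i)] at hsum
      exact zero_ne_one hsum
    refine ⟨j, fun i => ?_⟩
    split_ifs with hij
    · rw [hij, hj]
    · have hnonneg : ∀ k, 0 ≤ A k q.1 q.2 := fun k => by
        rcases hA.1 k q.1 q.2 with h | h <;> simp [h]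
      rw [← Finset.add_sum_erase _ _ (Finset.mem_univ j), hj, add_eq_left,
        Finset.sum_eq_zero_iff_of_nonneg fun k _ => hnonneg k] at hsum
      exact hsum i (by simp [hij])
  choose col hcol using h
  exact ⟨col, fun i x y => hcol (x, y) i⟩

theorem mul_mem_span (hA : IsCoherentConfig A) {M N : Matrix V V ℝ}
    (hM : M ∈ Submodule.span ℝ (Set.range A)) (hN : N ∈ Submodule.span ℝ (Set.range A)) :
    M * N ∈ Submodule.span ℝ (Set.range A) := by
  induction hM using Submodule.span_induction with
  | mem M hM =>
    obtain ⟨i, rfl⟩ := hM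
    induction hN using Submodule.span_induction with
    | mem N hN =>
      obtain ⟨j, rfl⟩ := hN
      exact hA.2.2.2.2 i j
    | zero => simp
    | add N N' _ _ h h' => rw [mul_add]; exact add_mem h h'
    | smul t N _ h => rw [mul_smul_comm]; exact Submodule.smul_mem _ t h
  | zero => simp
  | add M M' _ _ h h' => rw [add_mul]; exact add_mem h h'
  | smul t M _ h => rw [smul_mul_assoc]; exact Submodule.smul_mem _ t h

theorem exists_isCoherentColoring (hA : IsCoherentConfig A) :
    ∃ col : V × V → Fin r, IsCoherentColoring col ∧
      ∀ M ∈ Submodule.span ℝ (Set.range A),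
        (fun q : V × V => M q.1 q.2).FactorsThrough col := by
  obtain ⟨col, hcol⟩ := hA.exists_color
  refine ⟨col, ⟨?_, ?_⟩, fun M => (mem_span_range_iff_factorsThrough hcol).1⟩
  · intro x y z hxyz
    obtain ⟨Δ, hΔ⟩ := hA.2.2.2.1
    have h1 : (1 : Matrix V V ℝ) ∈ Submodule.span ℝ (Set.range A) :=
      hΔ ▸ sum_mem fun i _ => Submodule.subset_span ⟨i, rfl⟩
    have h2 : (1 : Matrix V V ℝ) x x = (1 : Matrix V V ℝ) y z :=
      (mem_span_range_iff_factorsThrough hcol).1 h1 hxyz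
    by_contra hyz
    rw [Matrix.one_apply_eq, Matrix.one_apply_ne hyz] at h2
    exact one_ne_zero h2
  · intro F K hF hK
    have hF' := (mem_span_range_iff_factorsThrough (M := Matrix.of fun x y => F (x, y)) hcol).2 hF
    have hK' := (mem_span_range_iff_factorsThrough (M := Matrix.of fun x y => K (x, y)) hcol).2 hK
    exact (mem_span_range_iff_factorsThrough hcol).1 (hA.mul_mem_span hF' hK')

end IsCoherentConfig

namespace IsCoherentColoring

variable {V : Type} [Fintype V] {r : ℕ} {col : V × V → Fin r}

theorem diag_left (hc : IsCoherentColoring col) {x y x' y' : V} (h : col (x, y) = col (x', y')) :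
    col (x, x) = col (x', x') := by
  have h1 := hc.mul (F := fun q => if col q = col (x, x) then 1 else 0) (K := fun _ => 1)
    (fun q q' hq => by simp only [hq]) (fun _ _ _ => rfl) h
  simp only [mul_one] at h1
  by_contra hne
  refine absurd h1 (ne_of_gt ?_)
  rw [Finset.sum_eq_zero]
  · exact Finset.sum_pos' (fun _ _ => by split_ifs <;> norm_num) ⟨x, Finset.mem_univ x, by simp⟩
  · intro z _
    rw [if_neg]
    intro hz
    obtain rfl := hc.diag hz.symm
    exact hne hz.symm

theorem diag_right (hc : IsCoherentColoring col) {x y x' y' : V} (h : col (x, y) = col (x', y')) :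
    col (y, y) = col (y', y') := by
  have h1 := hc.mul (F := fun _ => 1) (K := fun q => if col q = col (y, y) then 1 else 0)
    (fun _ _ _ => rfl) (fun q q' hq => by simp only [hq]) h
  simp only [one_mul] at h1
  by_contra hne
  refine absurd h1 (ne_of_gt ?_)
  rw [Finset.sum_eq_zero]
  · exact Finset.sum_pos' (fun _ _ => by split_ifs <;> norm_num) ⟨y, Finset.mem_univ y, by simp⟩
  · intro z _
    rw [if_neg]
    intro hz
    obtain rfl := hc.diag hz.symm
    exact hne hz.symm

theorem sq_card_fibers_le (hc : IsCoherentColoring col) :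
    (Finset.univ.image fun x => col (x, x)).card ^ 2 ≤ r := by
  rw [sq, ← Finset.card_product]
  obtain ⟨e, he⟩ : ∃ e : Fin r × Fin r → Fin r, ∀ x y,
      ∃ x' y', col (x', x') = col (x, x) ∧ col (y', y') = col (y, y) ∧
        e (col (x, x), col (y, y)) = col (x', y') := by
    have h : ∀ s : Fin r × Fin r, ∃ i, ∀ x y, s = (col (x, x), col (y, y)) →
        ∃ x' y', col (x', x') = col (x, x) ∧ col (y', y') = col (y, y) ∧ i = col (x', y') := by
      intro s
      by_cases hs : ∃ x y, s = (col (x, x), col (y, y))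
      · obtain ⟨x, y, rfl⟩ := hs
        refine ⟨col (x, y), fun x' y' h => ⟨x, y, ?_, ?_, rfl⟩⟩
        · exact congrArg Prod.fst h
        · exact congrArg Prod.snd h
      · exact ⟨s.1, fun x y h => absurd ⟨x, y, h⟩ hs⟩
    choose e he using h
    exact ⟨e, fun x y => he _ x y rfl⟩
  refine (Finset.card_le_card_of_injOn e (fun _ _ => Finset.mem_univ _) ?_).trans
    (Finset.card_fin r).le
  rintro ⟨s, t⟩ hs ⟨s', t'⟩ hs' heq
  simp only [Finset.coe_product, Set.mem_prod, Finset.coe_image, Set.mem_image, Finset.coe_univ,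
    Set.mem_univ, true_and] at hs hs'
  obtain ⟨⟨x, rfl⟩, y, rfl⟩ := hs
  obtain ⟨⟨x', rfl⟩, y', rfl⟩ := hs'
  obtain ⟨x1, y1, hx1, hy1, h1⟩ := he x y
  obtain ⟨x2, y2, hx2, hy2, h2⟩ := he x' y'
  rw [h1, h2] at heq
  rw [← hx1, ← hy1, ← hx2, ← hy2, hc.diag_left heq, hc.diag_right heq]

/-- If a vertex function is constant on fibres and takes three values, while the rank is less
than `16`, then its level sets are the fibres. -/
theorem fiber_eq_of_lt (hc : IsCoherentColoring col) (hr : r < 16) {α : V → ℝ}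
    (hα : ∀ x y, col (x, x) = col (y, y) → α x = α y) {x₁ x₂ x₃ : V} (h12 : α x₁ ≠ α x₂)
    (h13 : α x₁ ≠ α x₃) (h23 : α x₂ ≠ α x₃)
    {x y : V} (hxy : α x = α y) : col (x, x) = col (y, y) := by
  have hcard : (Finset.univ.image fun x => col (x, x)).card ≤ 3 := by
    have := hc.sq_card_fibers_le
    by_contra! h4
    nlinarith
  have h3 : ({col (x₁, x₁), col (x₂, x₂), col (x₃, x₃)} : Finset (Fin r)).card = 3 :=
    Finset.card_eq_three.2 ⟨_, _, _, fun h => h12 (hα _ _ h), fun h => h13 (hα _ _ h),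
      fun h => h23 (hα _ _ h), rfl⟩
  have heq := Finset.eq_of_subset_of_card_le
    (s := {col (x₁, x₁), col (x₂, x₂), col (x₃, x₃)})
    (t := Finset.univ.image fun x => col (x, x)) (by
      intro i hi
      simp only [Finset.mem_insert, Finset.mem_singleton] at hi
      rcases hi with rfl | rfl | rfl <;> simp) (by rw [h3]; exact hcard)
  have hmem : ∀ z, col (z, z) = col (x₁, x₁) ∨ col (z, z) = col (x₂, x₂) ∨
      col (z, z) = col (x₃, x₃) := by
    intro z
    have : col (z, z) ∈ Finset.univ.image fun x => col (x, x) := by simp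
    rw [← heq] at this
    simpa using this
  rcases hmem x with h | h | h <;> rcases hmem y with h' | h' | h' <;>
    first
    | exact h.trans h'.symm
    | exact absurd ((hα _ _ h).symm.trans (hxy.trans (hα _ _ h'))) ‹_›
    | exact absurd ((hα _ _ h').symm.trans (hxy.symm.trans (hα _ _ h))) ‹_›

end IsCoherentColoring

open Classical in
/-- The colours between the level sets `α = s` and `α = t`. -/
noncomputable def blockColors {V : Type} [Fintype V] {r : ℕ} (col : V × V → Fin r) (α : V → ℝ)
    (q : ℝ × ℝ) : Finset (Fin r) :=
  Finset.univ.filter fun i => ∃ x y, α x = q.1 ∧ α y = q.2 ∧ col (x, y) = i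

section Blocks

variable {V : Type} [Fintype V] {r : ℕ} {col : V × V → Fin r} {α : V → ℝ}

theorem mem_blockColors {s t : ℝ} {i : Fin r} :
    i ∈ blockColors col α (s, t) ↔ ∃ x y, α x = s ∧ α y = t ∧ col (x, y) = i := by
  simp [blockColors]

theorem color_mem_blockColors {s t : ℝ} {x y : V} (hx : α x = s) (hy : α y = t) :
    col (x, y) ∈ blockColors col α (s, t) :=
  mem_blockColors.2 ⟨x, y, hx, hy, rfl⟩

theorem one_le_card_blockColors {s t : ℝ} {x y : V} (hx : α x = s) (hy : α y = t) :
    1 ≤ (blockColors col α (s, t)).card :=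
  Finset.card_pos.2 ⟨_, color_mem_blockColors hx hy⟩

theorem two_le_card_blockColors {s t : ℝ} {x y x' y' : V} (hx : α x = s) (hy : α y = t)
    (hx' : α x' = s) (hy' : α y' = t) (hne : col (x, y) ≠ col (x', y')) :
    2 ≤ (blockColors col α (s, t)).card :=
  Finset.one_lt_card.2 ⟨_, color_mem_blockColors hx hy, _, color_mem_blockColors hx' hy', hne⟩

theorem three_le_card_blockColors {a : V → V → ℝ} (hc : IsCoherentColoring col)
    (ha : ∀ {x y x' y'}, col (x, y) = col (x', y') → a x y = a x' y') {s : ℝ} {x y x' y' : V}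
    (hx : α x = s) (hy : α y = s) (hx' : α x' = s) (hy' : α y' = s) (hxy : x ≠ y)
    (hxy' : x' ≠ y') (hne : a x y ≠ a x' y') : 3 ≤ (blockColors col α (s, s)).card :=
  Finset.two_lt_card.2 ⟨_, color_mem_blockColors hx hx, _, color_mem_blockColors hx hy, _,
    color_mem_blockColors hx' hy', fun h => hxy (hc.diag h),
    fun h => hxy' (hc.diag h), fun h => hne (ha h)⟩

theorem sum_card_blockColors_le
    (hα : ∀ {x y x' y'}, col (x, y) = col (x', y') → α x = α x' ∧ α y = α y') {u v p : ℝ}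
    (huv : u ≠ v) (hup : u ≠ p) (hvp : v ≠ p) :
    (blockColors col α (u, u)).card + (blockColors col α (u, v)).card +
      (blockColors col α (u, p)).card + ((blockColors col α (v, u)).card +
      (blockColors col α (v, v)).card + (blockColors col α (v, p)).card) +
      ((blockColors col α (p, u)).card + (blockColors col α (p, v)).card +
      (blockColors col α (p, p)).card) ≤ r := by
  have hdisj : ∀ q ∈ ({u, v, p} : Finset ℝ) ×ˢ ({u, v, p} : Finset ℝ),
      ∀ q' ∈ ({u, v, p} : Finset ℝ) ×ˢ ({u, v, p} : Finset ℝ), q ≠ q' →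
      Disjoint (blockColors col α q) (blockColors col α q') := by
    rintro ⟨s, t⟩ - ⟨s', t'⟩ - hne
    rw [Finset.disjoint_left]
    intro i hi hi'
    obtain ⟨x, y, hx, hy, h⟩ := mem_blockColors.1 hi
    obtain ⟨x', y', hx', hy', h'⟩ := mem_blockColors.1 hi'
    have := hα (h.trans h'.symm)
    rw [hx, hy, hx', hy'] at this
    exact hne (Prod.ext this.1 this.2)
  have h := (Finset.card_biUnion hdisj).symm.le.trans (Finset.card_le_univ _)
  rw [Fintype.card_fin, Finset.sum_product] at h
  simpa [huv, hup, hvp, add_assoc] using h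

end Blocks

namespace RankOneSquare

variable {V : Type} [Fintype V] [DecidableEq V] {a : V → V → ℝ} {α : V → ℝ} {σ c θ : ℝ}
  {r : ℕ} {col : V × V → Fin r}

theorem eq_of_color_eq (H : RankOneSquare a α σ c θ) (hc : IsCoherentColoring col)
    (ha : ∀ {x y x' y'}, col (x, y) = col (x', y') → a x y = a x' y') {x y x' y' : V}
    (h : col (x, y) = col (x', y')) : α x = α x' ∧ α y = α y' := by
  have key : ∀ {x x'}, col (x, x) = col (x', x') → α x = α x' := by
    intro x x' h
    have h1 := hc.mul (F := fun q => a q.1 q.2) (K := fun _ => 1) (fun _ _ h => ha h)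
      (fun _ _ _ => rfl) h
    simp only [mul_one, H.row_sum, add_right_inj] at h1
    exact (pow_left_inj₀ (H.pos x).le (H.pos x').le two_ne_zero).1 h1
  exact ⟨key (hc.diag_left h), key (hc.diag_right h)⟩

theorem block_row_sum_eq (H : RankOneSquare a α σ c θ) (hc : IsCoherentColoring col)
    (ha : ∀ {x y x' y'}, col (x, y) = col (x', y') → a x y = a x' y') {x x' : V}
    (h : col (x, x) = col (x', x')) (t : ℝ) :
    ∑ w with α w = t, a x w = ∑ w with α w = t, a x' w := by
  have h1 := hc.mul (F := fun q => if α q.2 = t then a q.1 q.2 else 0) (K := fun _ => 1)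
    (fun q q' hq => by
      have h2 : α q.2 = α q'.2 := (H.eq_of_color_eq hc ha hq).2
      have h3 : a q.1 q.2 = a q'.1 q'.2 := ha hq
      simp only [h2, h3]) (fun _ _ _ => rfl) h
  simpa only [mul_one, ← Finset.sum_filter] using h1

theorem fourteen_le_of_mixed_block (H : RankOneSquare a α σ c θ) (hc : IsCoherentColoring col)
    (ha : ∀ {x y x' y'}, col (x, y) = col (x', y') → a x y = a x' y')
    (hfib : ∀ {x x'}, α x = α x' → col (x, x) = col (x', x')) {p u v : ℝ} (hpu : p ≠ u)
    (hpv : p ≠ v) (huv : u ≠ v) (hα : ∀ x, α x = u ∨ α x = v ∨ α x = p) {o x y x' y' : V}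
    (ho : α o = p) (hx : α x = u) (hy : α y = v) (hx' : α x' = u) (hy' : α y' = v)
    (hxy : a x y = 1) (hxy' : a x' y' = 0) : 14 ≤ r := by
  have row : ∀ t {w w'}, α w = α w' → ∑ z with α z = t, a w z = ∑ z with α z = t, a w' z :=
    fun t _ _ h => H.block_row_sum_eq hc ha (hfib h) t
  have single : ∀ {s : ℝ} {o : V}, α o = s → (∀ w, α w = s → w = o) → ∀ {w w' : V},
      α w = α w' → a w o = a w' o := by
    intro s o ho hs w w' hw
    have hf : (Finset.univ.filter fun z => α z = s) = {o} := by
      ext z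
      simp only [Finset.mem_filter, Finset.mem_univ, true_and, Finset.mem_singleton]
      exact ⟨hs z, fun h => h ▸ ho⟩
    have := row s hw
    rwa [hf, Finset.sum_singleton, Finset.sum_singleton] at this
  obtain ⟨x₁, hx₁, hxx₁⟩ : ∃ x₁, α x₁ = u ∧ x₁ ≠ x := by
    by_contra! hs
    have := single hx hs (hy.trans hy'.symm)
    rw [H.symm y, hxy, H.symm y', ← hs x' hx', hxy'] at this
    exact one_ne_zero this
  obtain ⟨y₁, hy₁, hyy₁⟩ : ∃ y₁, α y₁ = v ∧ y₁ ≠ y := by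
    by_contra! hs
    have := single hy hs (hx.trans hx'.symm)
    rw [hxy, ← hs y' hy', hxy'] at this
    exact one_ne_zero this
  have hle := sum_card_blockColors_le (H.eq_of_color_eq hc ha) huv hpu.symm hpv.symm
  have huu : 2 ≤ (blockColors col α (u, u)).card :=
    two_le_card_blockColors hx hx hx hx₁ fun h => hxx₁ (hc.diag h).symm
  have hvv : 2 ≤ (blockColors col α (v, v)).card :=
    two_le_card_blockColors hy hy hy hy₁ fun h => hyy₁ (hc.diag h).symm
  have huv2 : 2 ≤ (blockColors col α (u, v)).card :=
    two_le_card_blockColors hx hy hx' hy' fun h => by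
      have := ha h
      rw [hxy, hxy'] at this
      exact one_ne_zero this
  have hvu2 : 2 ≤ (blockColors col α (v, u)).card :=
    two_le_card_blockColors hy hx hy' hx' fun h => by
      have := ha h
      rw [H.symm y, H.symm y', hxy, hxy'] at this
      exact one_ne_zero this
  have hup1 : 1 ≤ (blockColors col α (u, p)).card := one_le_card_blockColors hx ho
  have hvp1 : 1 ≤ (blockColors col α (v, p)).card := one_le_card_blockColors hy ho
  have hpu1 : 1 ≤ (blockColors col α (p, u)).card := one_le_card_blockColors ho hx
  have hpv1 : 1 ≤ (blockColors col α (p, v)).card := one_le_card_blockColors ho hy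
  have hpp1 : 1 ≤ (blockColors col α (p, p)).card := one_le_card_blockColors ho ho
  by_contra! hlt
  have hpp : ∀ w, α w = p → w = o := by
    intro w hw
    by_contra hne
    have : 2 ≤ (blockColors col α (p, p)).card :=
      two_le_card_blockColors ho ho ho hw fun h => hne (hc.diag h).symm
    omega
  have he₁ : ∀ w w', α w = u → α w' = u → w ≠ w' → a w w' = a x x₁ := by
    intro w w' hw hw' hne
    by_contra h
    have := three_le_card_blockColors hc ha hw hw' hx hx₁ hne hxx₁.symm h
    omega
  have he₂ : ∀ w w', α w = v → α w' = v → w ≠ w' → a w w' = a y y₁ := by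
    intro w w' hw hw' hne
    by_contra h
    have := three_le_card_blockColors hc ha hw hw' hy hy₁ hne hyy₁.symm h
    omega
  refine H.no_design_quotient hpu hpv huv hα ho hpp (f₁ := a o x) (f₂ := a o y) ?_ ?_ he₁ he₂
    (fun w hw => row v (hw.trans hx.symm)) (fun w hw => row u (hw.trans hy.symm))
    hx hy hx' hy' hxy hxy'
  · intro w hw
    rw [H.symm o, H.symm o, single ho hpp (hw.trans hx.symm)]
  · intro w hw
    rw [H.symm o, H.symm o, single ho hpp (hw.trans hy.symm)]

theorem fourteen_le (H : RankOneSquare a α σ c θ) (hc : IsCoherentColoring col)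
    (ha : ∀ {x y x' y'}, col (x, y) = col (x', y') → a x y = a x' y') {x₁ x₂ x₃ : V}
    (h12 : α x₁ ≠ α x₂) (h13 : α x₁ ≠ α x₃) (h23 : α x₂ ≠ α x₃)
    (hα : ∀ x, α x = α x₁ ∨ α x = α x₂ ∨ α x = α x₃) : 14 ≤ r := by
  by_contra! hlt
  have hfib : ∀ {x x'}, α x = α x' → col (x, x) = col (x', x') := fun h =>
    hc.fiber_eq_of_lt (by omega) (fun _ _ h => (H.eq_of_color_eq hc ha h).1) h12 h13 h23 h
  have third : ∀ {x y : V}, α x ≠ α y → ∃ z, α z ≠ α x ∧ α z ≠ α y ∧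
      ∀ w, α w = α x ∨ α w = α y ∨ α w = α z := by
    intro x y hxy
    clear H hc ha hfib
    rcases hα x with hx | hx | hx <;> rcases hα y with hy | hy | hy <;>
      first
      | exact absurd (hx.trans hy.symm) hxy
      | exact ⟨x₁, by grind, by grind, by grind⟩
      | exact ⟨x₂, by grind, by grind, by grind⟩
      | exact ⟨x₃, by grind, by grind, by grind⟩
  refine H.not_all_blocks_constant h12 h13 h23 hα rfl rfl rfl fun x y x' y' hxy hx hy => ?_
  obtain ⟨z, hzx, hzy, hz⟩ := third hxy
  rcases H.zero_or_one x y with h | h <;> rcases H.zero_or_one x' y' with h' | h'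
  · rw [h, h']
  · exact absurd (H.fourteen_le_of_mixed_block hc ha hfib hzx hzy hxy hz rfl hx.symm hy.symm rfl
      rfl h' h) hlt.not_ge
  · exact absurd (H.fourteen_le_of_mixed_block hc ha hfib hzx hzy hxy hz rfl rfl rfl hx.symm
      hy.symm h h') hlt.not_ge
  · rw [h, h']

end RankOneSquare

/-- A triregular graph in `𝒢₃` has coherent rank at least `14`: every coherent configuration
whose real linear span contains its adjacency matrix has rank at least `14`. -/
theorem stmt13 {V : Type} [Fintype V] [DecidableEq V] (G : SimpleGraph V) [DecidableRel G.Adj]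
    (θ0 θ1 θ2 : ℝ) (h : InG3 G θ0 θ1 θ2)
    (d1 d2 d3 : ℕ) (hd12 : d1 ≠ d2) (hd13 : d1 ≠ d3) (hd23 : d2 ≠ d3)
    (hdeg : ∀ x : V, G.degree x = d1 ∨ G.degree x = d2 ∨ G.degree x = d3)
    (h1 : ∃ x : V, G.degree x = d1) (h2 : ∃ x : V, G.degree x = d2)
    (h3 : ∃ x : V, G.degree x = d3) :
    ∀ (r : ℕ) (A : Fin r → Matrix V V ℝ), IsCoherentConfig A →
      SimpleGraph.adjMatrix ℝ G ∈ Submodule.span ℝ (Set.range A) → 14 ≤ r := by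
  intro r A hA hspan
  obtain ⟨α, σ, c, θ, H⟩ := h.exists_rankOneSquare
  obtain ⟨col, hc, hcol⟩ := hA.exists_isCoherentColoring
  have hrow : ∀ x, (G.degree x : ℝ) = c + α x ^ 2 := by
    intro x
    rw [← H.row_sum x]
    simp [SimpleGraph.adjMatrix_apply, ← SimpleGraph.card_neighborFinset_eq_degree,
      SimpleGraph.neighborFinset_eq_filter]
  have hne : ∀ {x y}, G.degree x ≠ G.degree y → α x ≠ α y := by
    intro x y hxy h
    refine hxy (Nat.cast_injective (R := ℝ) ?_)
    rw [hrow, hrow, h]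
  have heq : ∀ {x y}, G.degree x = G.degree y → α x = α y := by
    intro x y hxy
    refine (pow_left_inj₀ (H.pos x).le (H.pos y).le two_ne_zero).1 (add_left_cancel (a := c) ?_)
    rw [← hrow, ← hrow, hxy]
  obtain ⟨x₁, rfl⟩ := h1
  obtain ⟨x₂, rfl⟩ := h2
  obtain ⟨x₃, rfl⟩ := h3
  exact H.fourteen_le hc (fun h => hcol _ hspan h) (hne hd12) (hne hd13) (hne hd23)
    fun x => (hdeg x).imp heq (Or.imp heq heq)
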